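/- For every complex number a with a ≠ 0 and a ≠ −1, the 7-dimensional complex Lie algebra N(a) with basis e1,...,e7 and nonzero brackets [e2,e5] = (a+1)·e1, [e3,e6] = e1, [e4,e7] = e1, [e5,e6] = −a·e4, [e5,e7] = e3, [e6,e7] = e2 (extended antisymmetrically and bilinearly) satisfies N(a) ≅ N(1/a) and N(a) ≅ N(−1−a) as complex Lie algebras. -/

import Mathlib

/-- The bilinear antisymmetric extension of the bracket relations
`[e2,e5] = (a+1)•e1`, `[e3,e6] = e1`, `[e4,e7] = e1`, `[e5,e6] = -a•e4`, `[e5,e7] = e3`,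
`[e6,e7] = e2` (all other brackets of basis vectors zero) on a 7-dimensional space:
the one-parameter family of nilpotent Lie algebras `G'₍₁₅,₆₎(a)`, written in coordinates. -/
noncomputable def br (a : ℂ) (x y : Fin 7 → ℂ) : Fin 7 → ℂ :=
  ![(a + 1) * (x 1 * y 4 - x 4 * y 1) + (x 2 * y 5 - x 5 * y 2) + (x 3 * y 6 - x 6 * y 3),
    x 5 * y 6 - x 6 * y 5,
    x 4 * y 6 - x 6 * y 4,
    -a * (x 4 * y 5 - x 5 * y 4),
    0,
    0,
    0]

/-- Exchanging the sixth and seventh basis vectors induces `N(a) ≅ N(1/a)`. -/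
noncomputable def invEquiv (a : ℂ) (ha : a ≠ 0) : (Fin 7 → ℂ) ≃ₗ[ℂ] (Fin 7 → ℂ) where
  toFun x := ![-a⁻¹ * x 0, -x 1, -a⁻¹ * x 3, -a⁻¹ * x 2, x 4, x 6, x 5]
  invFun y := ![-a * y 0, -y 1, -a * y 3, -a * y 2, y 4, y 6, y 5]
  map_add' x y := by ext i; fin_cases i <;> simp <;> ring
  map_smul' c x := by ext i; fin_cases i <;> simp <;> ring
  left_inv x := by ext i; fin_cases i <;> simp [ha]
  right_inv x := by ext i; fin_cases i <;> simp [ha]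

theorem invEquiv_br (a : ℂ) (ha : a ≠ 0) (x y : Fin 7 → ℂ) :
    invEquiv a ha (br a x y) = br a⁻¹ (invEquiv a ha x) (invEquiv a ha y) := by
  ext i
  fin_cases i <;> simp [invEquiv, br] <;> field_simp <;> ring

/-- Exchanging the fifth and seventh basis vectors induces `N(a) ≅ N(-1-a)`. -/
noncomputable def negOneSubEquiv (a : ℂ) (ha : a ≠ 0) (hb : -1 - a ≠ 0) :
    (Fin 7 → ℂ) ≃ₗ[ℂ] (Fin 7 → ℂ) where
  toFun x := ![-x 0, a⁻¹ * x 3, -x 2, (-1 - a) * x 1, x 6, x 5, x 4]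
  invFun y := ![-y 0, (-1 - a)⁻¹ * y 3, -y 2, a * y 1, y 6, y 5, y 4]
  map_add' x y := by ext i; fin_cases i <;> simp <;> ring
  map_smul' c x := by ext i; fin_cases i <;> simp <;> ring
  left_inv x := by ext i; fin_cases i <;> simp [ha, hb]
  right_inv x := by ext i; fin_cases i <;> simp [ha, hb]

theorem negOneSubEquiv_br (a : ℂ) (ha : a ≠ 0) (hb : -1 - a ≠ 0) (x y : Fin 7 → ℂ) :
    negOneSubEquiv a ha hb (br a x y) =
      br (-1 - a) (negOneSubEquiv a ha hb x) (negOneSubEquiv a ha hb y) := by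
  ext i
  fin_cases i <;> simp [negOneSubEquiv, br] <;> field_simp <;> ring

/-- For every `a : ℂ` with `a ≠ 0` and `a ≠ -1`, the nilpotent Lie algebra
`N(a) = G'₍₁₅,₆₎(a)` is isomorphic, as a complex Lie algebra, to `N(1/a)` and to `N(-1-a)`. -/
theorem G15_6_isos (a : ℂ) (ha : a ≠ 0) (ha' : a ≠ -1) :
    (∃ f : (Fin 7 → ℂ) ≃ₗ[ℂ] (Fin 7 → ℂ),
      ∀ x y : Fin 7 → ℂ, f (br a x y) = br a⁻¹ (f x) (f y)) ∧
    (∃ g : (Fin 7 → ℂ) ≃ₗ[ℂ] (Fin 7 → ℂ),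
      ∀ x y : Fin 7 → ℂ, g (br a x y) = br (-1 - a) (g x) (g y)) := by
  have hb : -1 - a ≠ 0 := fun h => ha' (by linear_combination -h)
  exact ⟨⟨invEquiv a ha, invEquiv_br a ha⟩, ⟨negOneSubEquiv a ha hb, negOneSubEquiv_br a ha hb⟩⟩
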